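/- arXiv:1902.06401 — 3 statements merged into one kernel-verified Lean document; each statement's English description precedes it below -/
import Mathlib

section
/- Let X_1, X_2, …, X_n be real symmetric positive semidefinite matrices and suppose rank(Σ_{i∈[n]} X_i) = k. Then there exists a subset I ⊆ [n] with |I| ≤ k such that the column space of Σ_{i∈I} X_i equals the column space of Σ_{i∈[n]} X_i (where the empty sum is interpreted as the zero matrix). -/
lemma aux_range {d : ℕ} (A T : Matrix (Fin d) (Fin d) ℝ) (hA : A.transpose = A)
    (hT : T.transpose = T) (h : ∀ x, A.mulVec x = 0 → T.mulVec x = 0) :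
    LinearMap.range T.mulVecLin ≤ LinearMap.range A.mulVecLin := by
  obtain ⟨s, hs⟩ := A.mulVecLin.rangeRestrict.exists_rightInverse_of_surjective
    (LinearMap.range_rangeRestrict _)
  obtain ⟨g, hg⟩ := LinearMap.exists_extend s
  have key : ∀ x, A.mulVec (g (A.mulVec x)) = A.mulVec x := by
    intro x
    have h1 := LinearMap.congr_fun hg (A.mulVecLin.rangeRestrict x)
    have h2 := LinearMap.congr_fun hs (A.mulVecLin.rangeRestrict x)
    rw [LinearMap.comp_apply, ← h1] at h2
    simpa using congrArg Subtype.val h2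
  have e : T = T * (LinearMap.toMatrix' g * A) := by
    apply Matrix.toLin'.injective
    refine LinearMap.ext fun x => ?_
    have h0 : T.mulVec (x - g (A.mulVec x)) = 0 := h _ (by rw [Matrix.mulVec_sub, key, sub_self])
    rw [Matrix.mulVec_sub, sub_eq_zero] at h0
    rw [Matrix.toLin'_apply, Matrix.toLin'_apply, ← Matrix.mulVec_mulVec, ← Matrix.mulVec_mulVec,
      LinearMap.toMatrix'_mulVec]
    exact h0
  have e2 : T = A * (LinearMap.toMatrix' g).transpose * T := by
    have := congrArg Matrix.transpose e
    simpa [Matrix.transpose_mul, hA, hT] using this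
  rw [e2, Matrix.mul_assoc, Matrix.mulVecLin_mul]
  exact LinearMap.range_comp_le_range _ _

lemma aux_add {d : ℕ} (A B : Matrix (Fin d) (Fin d) ℝ) (hA : A.PosSemidef)
    (hB : B.PosSemidef) :
    LinearMap.ker (A + B).mulVecLin = LinearMap.ker A.mulVecLin ⊓ LinearMap.ker B.mulVecLin := by
  ext x
  simp only [Submodule.mem_inf, LinearMap.mem_ker, Matrix.mulVecLin_apply]
  constructor
  · intro h
    have h1 := hA.dotProduct_mulVec_nonneg x
    have h2 := hB.dotProduct_mulVec_nonneg x
    have h3 : star x ⬝ᵥ A.mulVec x + star x ⬝ᵥ B.mulVec x = 0 := by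
      rw [← dotProduct_add, ← Matrix.add_mulVec, h, dotProduct_zero]
    rw [← hA.dotProduct_mulVec_zero_iff, ← hB.dotProduct_mulVec_zero_iff]
    constructor <;> linarith
  · rintro ⟨h1, h2⟩
    rw [Matrix.add_mulVec, h1, h2, add_zero]

lemma aux_main {d n : ℕ} (X : Fin n → Matrix (Fin d) (Fin d) ℝ)
    (hX : ∀ i, (X i).PosSemidef) (J : Finset (Fin n)) :
    ∃ I : Finset (Fin n), I ⊆ J ∧ I.card ≤ (∑ i ∈ J, X i).rank ∧
      LinearMap.ker (∑ i ∈ I, X i).mulVecLin = LinearMap.ker (∑ i ∈ J, X i).mulVecLin := by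
  classical
  have hs : ∀ J : Finset (Fin n), (∑ i ∈ J, X i).PosSemidef := fun J =>
    Matrix.posSemidef_sum J (fun i _ => hX i)
  induction J using Finset.induction_on with
  | empty => exact ⟨∅, by simp⟩
  | insert a J ha ih =>
    obtain ⟨I, hIJ, hc, hk⟩ := ih
    have rn := fun M : Matrix (Fin d) (Fin d) ℝ => M.mulVecLin.finrank_range_add_finrank_ker
    have haI : a ∉ I := fun h => ha (hIJ h)
    have hker := aux_add _ _ (hX a) (hs J)
    have r1 := rn (X a + ∑ i ∈ J, X i)
    have r2 := rn (∑ i ∈ J, X i)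
    by_cases hle : LinearMap.ker (∑ i ∈ J, X i).mulVecLin ≤ LinearMap.ker (X a).mulVecLin
    · rw [inf_eq_right.2 hle] at hker
      refine ⟨I, hIJ.trans (Finset.subset_insert _ _), ?_, ?_⟩
      · rw [Finset.sum_insert ha]
        rw [hker] at r1
        unfold Matrix.rank at *
        omega
      · rw [Finset.sum_insert ha, hker, hk]
    · refine ⟨insert a I, Finset.insert_subset_insert _ hIJ, ?_, ?_⟩
      · rw [Finset.sum_insert ha, Finset.card_insert_of_notMem haI]
        have hlt : LinearMap.ker (X a + ∑ i ∈ J, X i).mulVecLin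
            < LinearMap.ker (∑ i ∈ J, X i).mulVecLin := by
          rw [hker]; exact inf_lt_right.2 hle
        have := Submodule.finrank_lt_finrank_of_lt hlt
        unfold Matrix.rank at *
        omega
      · rw [Finset.sum_insert ha, Finset.sum_insert haI, hker, aux_add _ _ (hX a) (hs I), hk]

/-- If `X₁, …, Xₙ` are real symmetric positive semidefinite matrices with
`rank(Σᵢ Xᵢ) = k`, then there is `I ⊆ [n]` with `|I| ≤ k` such that the column space of
`Σ_{i ∈ I} Xᵢ` equals the column space of `Σ_{i ∈ [n]} Xᵢ`. -/
theorem statement_5 {d n k : ℕ} (X : Fin n → Matrix (Fin d) (Fin d) ℝ)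
    (hX : ∀ i, (X i).PosSemidef) (hrk : (∑ i, X i).rank = k) :
    ∃ I : Finset (Fin n), I.card ≤ k ∧
      LinearMap.range (∑ i ∈ I, X i).mulVecLin = LinearMap.range (∑ i, X i).mulVecLin := by
  obtain ⟨I, -, hc, hk⟩ := aux_main X hX Finset.univ
  have ht : ∀ J : Finset (Fin n), (∑ i ∈ J, X i).transpose = ∑ i ∈ J, X i := fun J => by
    have := (Matrix.posSemidef_sum J (fun i _ => hX i)).isHermitian.eq
    rwa [Matrix.conjTranspose_eq_transpose_of_trivial] at this
  refine ⟨I, hrk ▸ hc, le_antisymm ?_ ?_⟩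
  · exact aux_range _ _ (ht _) (ht _) (fun x hx => (SetLike.ext_iff.1 hk x).2 hx)
  · exact aux_range _ _ (ht _) (ht _) (fun x hx => (SetLike.ext_iff.1 hk x).1 hx)
end

section
/- Let k ≥ 1 and for each i ∈ ℕ let v_i = (1, i, i², …, i^k) ∈ ℝ^{k+1}. Then the cone S₊^{k+1} of (k+1)×(k+1) real symmetric positive semidefinite matrices is k-neighborly with respect to the infinite set V = { v_i v_iᵀ / ‖v_i‖² : i ∈ ℕ } of normalized extreme rays: each v_i v_iᵀ / ‖v_i‖² is a unit-norm generator of an extreme ray of S₊^{k+1}, and for every k-element subset W ⊂ V there exists a positive semidefinite matrix f_W with ⟨f_W, v⟩ = 0 (trace inner product) for all v ∈ W and ⟨f_W, v⟩ > 0 for all v ∈ V ∖ W. -/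
/-- A face of a convex cone. -/
def IsFace {E : Type*} [AddCommGroup E] [Module ℝ E] (K F : Set E) : Prop :=
  F ⊆ K ∧ Convex ℝ F ∧
    ∀ ⦃x⦄, x ∈ K → ∀ ⦃y⦄, y ∈ K → ∀ ⦃α : ℝ⦄, 0 < α → α < 1 →
      α • x + (1 - α) • y ∈ F → x ∈ F ∧ y ∈ F

/-- The ray generated by `v`. -/
def rayOf {E : Type*} [AddCommGroup E] [Module ℝ E] (v : E) : Set E :=
  {x | ∃ t : ℝ, 0 ≤ t ∧ x = t • v}

/-- `v` generates an extreme ray of `K`. -/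
def IsExtremeRay {E : Type*} [AddCommGroup E] [Module ℝ E] (K : Set E) (v : E) : Prop :=
  v ∈ K ∧ v ≠ 0 ∧ IsFace K (rayOf v)

open Matrix in
theorem psd_rank_one_aux {n : Type*} [Fintype n] [DecidableEq n] (A B : Matrix n n ℝ) (hA : A.PosSemidef)
    (hB : B.PosSemidef) (v : n → ℝ) (hv : 0 < v ⬝ᵥ v) (c : ℝ)
    (h : A + B = c • vecMulVec v v) : ∃ s : ℝ, 0 ≤ s ∧ A = s • vecMulVec v v := by
  have key : ∀ w, v ⬝ᵥ w = 0 → A *ᵥ w = 0 := by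
    intro w hw
    have h1 := hA.dotProduct_mulVec_nonneg w
    have h2 := hB.dotProduct_mulVec_nonneg w
    have h3 : star w ⬝ᵥ (A *ᵥ w) + star w ⬝ᵥ (B *ᵥ w) = 0 := by
      rw [← dotProduct_add, ← add_mulVec, h, smul_mulVec, vecMulVec_mulVec, hw]
      simp
    exact (hA.dotProduct_mulVec_zero_iff w).1 (by linarith)
  have key2 : ∀ u, (v ⬝ᵥ v) • A *ᵥ u = (v ⬝ᵥ u) • A *ᵥ v := by
    intro u
    have := key ((v ⬝ᵥ v) • u - (v ⬝ᵥ u) • v) (by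
      rw [dotProduct_sub, dotProduct_smul, dotProduct_smul]; simp only [smul_eq_mul]; ring)
    rw [mulVec_sub, mulVec_smul, mulVec_smul] at this
    exact sub_eq_zero.1 this
  have e1 : ∀ i j, (v ⬝ᵥ v) * A i j = v j * (A *ᵥ v) i := by
    intro i j
    have := congrFun (key2 (Pi.single j 1)) i
    simpa using this
  have sym : ∀ i j, A i j = A j i := fun i j => by
    have := hA.1.apply i j
    simpa using this.symm
  have e2 : ∀ i, (v ⬝ᵥ v) * (A *ᵥ v) i = v i * (v ⬝ᵥ (A *ᵥ v)) := by
    intro i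
    have l : (A *ᵥ v) i = ∑ j, A i j * v j := rfl
    have r : v ⬝ᵥ (A *ᵥ v) = ∑ j, v j * (A *ᵥ v) j := rfl
    rw [l, r, Finset.mul_sum, Finset.mul_sum]
    refine Finset.sum_congr rfl fun j _ => ?_
    have b := e1 j i
    rw [sym j i] at b
    linear_combination v j * b
  refine ⟨(v ⬝ᵥ (A *ᵥ v)) / (v ⬝ᵥ v) ^ 2, div_nonneg ?_ (by positivity), ?_⟩
  · simpa using hA.dotProduct_mulVec_nonneg v
  · ext i j
    simp only [Matrix.smul_apply, vecMulVec_apply, smul_eq_mul]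
    field_simp
    have a := e1 i j
    have b := e2 i
    linear_combination (v ⬝ᵥ v) * a + v j * b

/-- Let `k ≥ 1` and `vᵢ = (1, i, i², …, iᵏ)`. The cone `S₊^{k+1}` is
`k`-neighborly with respect to `V = {vᵢvᵢᵀ/‖vᵢ‖² : i ∈ ℕ}`: each `Mᵢ = vᵢvᵢᵀ/‖vᵢ‖²` is a
unit-norm (for the trace inner product) generator of an extreme ray of `S₊^{k+1}`, and for
every `k`-element subset `W ⊆ V` there is a positive semidefinite `f_W` with
`tr(f_W A) = 0` for `A ∈ W` and `tr(f_W A) > 0` for `A ∈ V \ W`. -/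
theorem statement_11 (k : ℕ) (hk : 1 ≤ k)
    (v : ℕ → Fin (k + 1) → ℝ) (hv : ∀ i j, v i j = (i : ℝ) ^ (j : ℕ))
    (M : ℕ → Matrix (Fin (k + 1)) (Fin (k + 1)) ℝ)
    (hM : ∀ i, M i = (∑ j, v i j ^ 2)⁻¹ • Matrix.vecMulVec (v i) (v i)) :
    (∀ i : ℕ, (M i).PosSemidef ∧ (M i * M i).trace = 1 ∧
      IsExtremeRay {A : Matrix (Fin (k + 1)) (Fin (k + 1)) ℝ | A.PosSemidef} (M i)) ∧
    ∀ W ⊆ Set.range M, W.Finite → W.ncard = k →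
      ∃ f : Matrix (Fin (k + 1)) (Fin (k + 1)) ℝ, f.PosSemidef ∧
        (∀ A ∈ W, (f * A).trace = 0) ∧
        ∀ A ∈ Set.range M \ W, 0 < (f * A).trace := by
  have hs : ∀ i, v i ⬝ᵥ v i = ∑ j, v i j ^ 2 := fun i => by
    simp only [dotProduct]; exact Finset.sum_congr rfl fun j _ => (sq _).symm
  have hpos : ∀ i, 0 < ∑ j, v i j ^ 2 := fun i => by
    refine Finset.sum_pos' (fun j _ => sq_nonneg _) ⟨0, Finset.mem_univ _, ?_⟩
    rw [hv]; simp
  have psdv : ∀ w : Fin (k + 1) → ℝ, (Matrix.vecMulVec w w).PosSemidef := fun w => by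
    simpa using Matrix.posSemidef_vecMulVec_self_star w
  have hpsd : ∀ i, (M i).PosSemidef := fun i => by
    rw [hM]; exact (psdv _).smul (inv_nonneg.2 (hpos i).le)
  have htr : ∀ c i, (Matrix.vecMulVec c c * M i).trace = (∑ j, v i j ^ 2)⁻¹ * (c ⬝ᵥ v i) ^ 2 := by
    intro c i
    rw [hM, Matrix.mul_smul, Matrix.trace_smul, Matrix.vecMulVec_mul_vecMulVec, Matrix.trace_vecMulVec,
      smul_eq_mul, dotProduct_smul, smul_eq_mul, sq]
  refine ⟨fun i => ?_, ?_⟩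
  · have h1 : (M i * M i).trace = 1 := by
      conv_lhs => rw [hM i, Matrix.smul_mul, ← hM i, Matrix.trace_smul, htr, hs]
      have := (hpos i).ne'
      rw [smul_eq_mul]
      field_simp
    refine ⟨hpsd i, h1, hpsd i, ?_, ?_, ?_, ?_⟩
    · intro h; rw [h] at h1; simp at h1
    · rintro _ ⟨t, ht, rfl⟩
      exact (hpsd i).smul ht
    · rintro _ ⟨t, ht, rfl⟩ _ ⟨u, hu, rfl⟩ a b ha hb _
      exact ⟨a * t + b * u, by positivity, by rw [add_smul, smul_smul, smul_smul]⟩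
    · have main : ∀ A B : Matrix (Fin (k + 1)) (Fin (k + 1)) ℝ, A.PosSemidef → B.PosSemidef →
          ∀ a t : ℝ, 0 < a → a • A + B = t • M i → A ∈ rayOf (M i) := by
        intro A B hA hB a t ha h
        rw [hM, smul_smul] at h
        obtain ⟨s, hs0, hs1⟩ := psd_rank_one_aux _ _ (hA.smul ha.le) hB (v i) (by rw [hs]; exact hpos i) _ h
        refine ⟨a⁻¹ * (s * ∑ j, v i j ^ 2), by have := hpos i; positivity, ?_⟩
        have h2 : A = a⁻¹ • (a • A) := by rw [smul_smul, inv_mul_cancel₀ ha.ne', one_smul]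
        rw [h2, hs1, hM, smul_smul, smul_smul]
        congr 1
        have := (hpos i).ne'
        field_simp
      rintro x hx y hy α h0 h1 ⟨t, ht, h⟩
      exact ⟨main x _ hx (Matrix.PosSemidef.smul hy (sub_pos.2 h1).le) α t h0 h,
        main y _ hy (Matrix.PosSemidef.smul hx h0.le) (1 - α) t (sub_pos.2 h1) ((add_comm _ _).trans h)⟩
  · intro W hW hfin hcard
    obtain ⟨S, hS⟩ : ∃ S : Set ℕ, Set.BijOn M S W := by
      have : Set.SurjOn M Set.univ W := by
        intro A hA
        obtain ⟨i, hi⟩ := hW hA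
        exact ⟨i, trivial, hi⟩
      obtain ⟨S, -, hS⟩ := this.exists_bijOn_subset
      exact ⟨S, hS⟩
    have hSf : S.Finite := by
      rw [← hS.image_eq] at hfin
      exact hfin.of_finite_image hS.injOn
    have hSc : hSf.toFinset.card = k := by
      rw [← Set.ncard_eq_toFinset_card S hSf, ← hcard, ← hS.image_eq, hS.injOn.ncard_image]
    let p : Polynomial ℝ := ∏ j ∈ hSf.toFinset, (Polynomial.X - Polynomial.C (j : ℝ))
    have hdeg : p.natDegree < k + 1 := by
      have : p.natDegree = k := by
        simp only [p]
        rw [Polynomial.natDegree_finsetProd_X_sub_C_eq_card, hSc]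
      omega
    have hev : ∀ i : ℕ, (fun j : Fin (k + 1) => p.coeff j) ⬝ᵥ v i = ∏ j ∈ hSf.toFinset, ((i : ℝ) - j) := by
      intro i
      have : p.eval (i : ℝ) = ∏ j ∈ hSf.toFinset, ((i : ℝ) - j) := by
        simp [p, Polynomial.eval_prod]
      rw [← this, Polynomial.eval_eq_sum_range' hdeg, Finset.sum_range]
      simp only [dotProduct, hv]
    refine ⟨Matrix.vecMulVec (fun j : Fin (k + 1) => p.coeff j) (fun j : Fin (k + 1) => p.coeff j), psdv _, ?_, ?_⟩
    · intro A hA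
      obtain ⟨i, hi, rfl⟩ := hS.surjOn hA
      rw [htr, hev, Finset.prod_eq_zero (i := i) (by simpa using hi) (sub_self _)]
      simp
    · rintro _ ⟨⟨i, rfl⟩, hi⟩
      rw [htr, hev]
      have h1 : ∏ j ∈ hSf.toFinset, ((i : ℝ) - j) ≠ 0 := by
        refine Finset.prod_ne_zero_iff.2 fun j hj h => hi ?_
        have : i = j := by exact_mod_cast sub_eq_zero.1 h
        subst this
        exact hS.mapsTo (by simpa using hj)
      have := hpos i
      positivity
end

section
/- For every positive integer k and every positive integer m, the cone S₊^{k+1} of (k+1)×(k+1) real symmetric positive semidefinite matrices does not have a (S₊^k)^m-lift; that is, there is no linear map π and linear subspace L of (S^k)^m with S₊^{k+1} = π((S₊^k)^m ∩ L). -/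
open Matrix in
lemma aux_dom {n : ℕ} {A B : Matrix (Fin n) (Fin n) ℝ} (hA : A.PosSemidef) (hB : B.PosSemidef)
    (h : LinearMap.ker A.mulVecLin ≤ LinearMap.ker B.mulVecLin) :
    ∃ M : ℝ, 0 ≤ M ∧ ∀ x, x ⬝ᵥ B *ᵥ x ≤ M * (x ⬝ᵥ A *ᵥ x) := by
  obtain ⟨p, a, ha⟩ := Matrix.posSemidef_iff_eq_sum_vecMulVec.mp hA
  obtain ⟨q, b, hb⟩ := Matrix.posSemidef_iff_eq_sum_vecMulVec.mp hB
  have key : ∀ (r : ℕ) (v : Fin r → Fin n → ℝ) (x : Fin n → ℝ),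
      x ⬝ᵥ (∑ i, vecMulVec (v i) (star (v i))) *ᵥ x = ∑ i, (v i ⬝ᵥ x) ^ 2 := by
    intro r v x
    rw [Matrix.sum_mulVec, dotProduct_sum]
    refine Finset.sum_congr rfl fun i _ => ?_
    rw [vecMulVec_mulVec]
    simp [dotProduct_comm x, sq]
  have hqA : ∀ x, x ⬝ᵥ A *ᵥ x = ∑ i, (a i ⬝ᵥ x) ^ 2 := fun x => by rw [ha]; exact key p a x
  have hqB : ∀ x, x ⬝ᵥ B *ᵥ x = ∑ i, (b i ⬝ᵥ x) ^ 2 := fun x => by rw [hb]; exact key q b x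
  have hc : ∀ i, ∃ c : Fin p → ℝ, ∀ x, b i ⬝ᵥ x = ∑ j, c j * (a j ⬝ᵥ x) := by
    intro i
    have hm : dotProductBilin ℝ ℝ (b i) ∈
        Submodule.span ℝ (Set.range fun j => dotProductBilin ℝ ℝ (a j)) := by
      apply mem_span_of_iInf_ker_le_ker
      intro x hx
      simp only [Submodule.mem_iInf, LinearMap.mem_ker, dotProductBilin_apply_apply] at hx ⊢
      have h0 : x ⬝ᵥ A *ᵥ x = 0 := by rw [hqA]; simp [hx]
      have h1 : A *ᵥ x = 0 := (hA.dotProduct_mulVec_zero_iff x).1 (by simpa using h0)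
      have h2 : B *ᵥ x = 0 := by simpa using h (show x ∈ LinearMap.ker A.mulVecLin by simpa using h1)
      have h3 := hqB x
      rw [h2, dotProduct_zero, eq_comm, Finset.sum_eq_zero_iff_of_nonneg (fun _ _ => sq_nonneg _)] at h3
      simpa using h3 i (Finset.mem_univ _)
    obtain ⟨c, hc⟩ := (Submodule.mem_span_range_iff_exists_fun ℝ).1 hm
    refine ⟨c, fun x => ?_⟩
    have := congrArg (fun f => f x) hc
    simpa using this.symm
  choose c hc using hc
  refine ⟨∑ i, ∑ j, c i j ^ 2, by positivity, fun x => ?_⟩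
  rw [hqA, hqB, Finset.sum_mul]
  refine Finset.sum_le_sum fun i _ => ?_
  rw [hc]
  exact Finset.sum_mul_sq_le_sq_mul_sq _ _ _

open Matrix in
lemma aux_ker {n : ℕ} {A B : Matrix (Fin n) (Fin n) ℝ} (hA : A.PosSemidef) (hB : B.PosSemidef) :
    LinearMap.ker (A + B).mulVecLin = LinearMap.ker A.mulVecLin ⊓ LinearMap.ker B.mulVecLin := by
  ext x
  simp only [LinearMap.mem_ker, Submodule.mem_inf, mulVecLin_apply]
  constructor
  · intro h
    have h0 : star x ⬝ᵥ A *ᵥ x + star x ⬝ᵥ B *ᵥ x = 0 := by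
      rw [← dotProduct_add, ← add_mulVec, h, dotProduct_zero]
    have h1 := hA.dotProduct_mulVec_nonneg x
    have h2 := hB.dotProduct_mulVec_nonneg x
    exact ⟨(hA.dotProduct_mulVec_zero_iff x).1 (by linarith),
      (hB.dotProduct_mulVec_zero_iff x).1 (by linarith)⟩
  · rintro ⟨h1, h2⟩
    rw [add_mulVec, h1, h2, add_zero]

lemma aux_psd {k m : ℕ} (X : ℕ → Fin m → Matrix (Fin k) (Fin k) ℝ)
    (hX : ∀ j c, (X j c).PosSemidef) (s : List ℕ) (c : Fin m) :
    ((s.map X).sum c).PosSemidef := by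
  induction s with
  | nil => simpa using Matrix.PosSemidef.zero
  | cons i s ih => simpa using (hX i c).add ih

open Matrix Filter in
lemma aux_comb {k m : ℕ} (X : ℕ → Fin m → Matrix (Fin k) (Fin k) ℝ)
    (hX : ∀ j c, (X j c).PosSemidef) (t : ℕ) :
    ∃ s : List ℕ, s.length = t ∧ ∀ c,
      (∀ᶠ j in (hyperfilter ℕ : Filter ℕ),
        LinearMap.ker ((s.map X).sum c).mulVecLin ≤ LinearMap.ker (X j c).mulVecLin) ∨
      Module.finrank ℝ (LinearMap.ker ((s.map X).sum c).mulVecLin) + t ≤ k := by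
  induction t with
  | zero =>
    refine ⟨[], rfl, fun c => Or.inr ?_⟩
    simpa using Submodule.finrank_le (LinearMap.ker ((([] : List ℕ).map X).sum c).mulVecLin)
  | succ t ih =>
    obtain ⟨s, hs, h⟩ := ih
    have hev : ∀ᶠ i in (hyperfilter ℕ : Filter ℕ), ∀ c,
        (∀ᶠ j in (hyperfilter ℕ : Filter ℕ),
          LinearMap.ker ((s.map X).sum c).mulVecLin ≤ LinearMap.ker (X j c).mulVecLin) ∨
        ¬ LinearMap.ker ((s.map X).sum c).mulVecLin ≤ LinearMap.ker (X i c).mulVecLin := by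
      rw [eventually_all]
      intro c
      rcases (hyperfilter ℕ).em fun i =>
        LinearMap.ker ((s.map X).sum c).mulVecLin ≤ LinearMap.ker (X i c).mulVecLin with h1 | h1
      · exact Eventually.of_forall fun _ => Or.inl h1
      · exact h1.mono fun _ h2 => Or.inr h2
    obtain ⟨i, hi⟩ := hev.exists
    refine ⟨i :: s, by simp [hs], fun c => ?_⟩
    have hk : LinearMap.ker (((i :: s).map X).sum c).mulVecLin =
        LinearMap.ker (X i c).mulVecLin ⊓ LinearMap.ker ((s.map X).sum c).mulVecLin := by
      rw [← aux_ker (hX i c) (aux_psd X hX s c)]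
      simp
    rw [hk]
    rcases hi c with h1 | h1
    · exact Or.inl (h1.mono fun j hj => inf_le_right.trans hj)
    · rcases h c with h2 | h2
      · exact Or.inl (h2.mono fun j hj => inf_le_right.trans hj)
      · right
        have : LinearMap.ker (X i c).mulVecLin ⊓ LinearMap.ker ((s.map X).sum c).mulVecLin <
            LinearMap.ker ((s.map X).sum c).mulVecLin :=
          lt_of_le_of_ne inf_le_right fun he => h1 (inf_eq_right.1 he)
        have := Submodule.finrank_lt_finrank_of_lt this
        omega

open Matrix Polynomial in
lemma aux_u (k : ℕ) (s : List ℕ) (hs : s.length = k) (j : ℕ) (hj : j ∉ s) :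
    ∃ u : Fin (k + 1) → ℝ, (∀ i ∈ s, u ⬝ᵥ (fun l : Fin (k + 1) => (i : ℝ) ^ (l : ℕ)) = 0) ∧
      u ⬝ᵥ (fun l : Fin (k + 1) => (j : ℝ) ^ (l : ℕ)) ≠ 0 := by
  let p : ℝ[X] := (s.map fun i : ℕ => (X - C (i : ℝ))).prod
  have hp : p.natDegree < k + 1 := by
    have h := natDegree_list_prod_le (s.map fun i : ℕ => (X - C (i : ℝ)))
    have h2 : ((s.map fun i : ℕ => (X - C (i : ℝ))).map natDegree).sum = k := by
      rw [List.map_map]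
      simp only [Function.comp_def, natDegree_X_sub_C]
      simp [hs]
    rw [h2] at h
    exact Nat.lt_succ_of_le h
  have he : ∀ x : ℝ, (fun l : Fin (k + 1) => p.coeff l) ⬝ᵥ (fun l : Fin (k + 1) => x ^ (l : ℕ))
      = (s.map fun i : ℕ => (x - i)).prod := by
    intro x
    have h1 : p.eval x = (s.map fun i : ℕ => (x - i)).prod := by
      simp only [p]
      rw [eval_list_prod, List.map_map]
      simp [Function.comp_def]
    rw [← h1, eval_eq_sum_range' hp, Finset.sum_range]
    rfl
  refine ⟨fun l => p.coeff l, fun i hi => ?_, ?_⟩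
  · rw [he]
    exact List.prod_eq_zero (List.mem_map.2 ⟨i, hi, sub_self _⟩)
  · rw [he]
    intro h0
    obtain ⟨i, hi, h⟩ := List.mem_map.1 (List.prod_eq_zero_iff.1 h0)
    have : j = i := by exact_mod_cast sub_eq_zero.1 h
    exact hj (this ▸ hi)

/-- For all positive integers `k` and `m`, the cone `S₊^{k+1}` of
`(k+1) × (k+1)` real symmetric positive semidefinite matrices has no `(S₊ᵏ)^m`-lift: there is
no linear map `π` and linear subspace `L` of `(Sᵏ)^m` with `S₊^{k+1} = π((S₊ᵏ)^m ∩ L)`. -/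
theorem statement_14 (k m : ℕ) (hk : 0 < k) (hm : 0 < m) :
    ¬ ∃ (π : (Fin m → Matrix (Fin k) (Fin k) ℝ) →ₗ[ℝ] Matrix (Fin (k + 1)) (Fin (k + 1)) ℝ)
        (L : Submodule ℝ (Fin m → Matrix (Fin k) (Fin k) ℝ)),
        {A : Matrix (Fin (k + 1)) (Fin (k + 1)) ℝ | A.PosSemidef} =
          π '' ({X | ∀ i, (X i).PosSemidef} ∩ (L : Set (Fin m → Matrix (Fin k) (Fin k) ℝ))) := by
  rintro ⟨π, L, h⟩
  let v : ℕ → Fin (k + 1) → ℝ := fun j l => (j : ℝ) ^ (l : ℕ)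
  have hl : ∀ j, ∃ X : Fin m → Matrix (Fin k) (Fin k) ℝ,
      (∀ c, (X c).PosSemidef) ∧ X ∈ L ∧ π X = Matrix.vecMulVec (v j) (v j) := by
    intro j
    have hv : Matrix.vecMulVec (v j) (v j) ∈
        {A : Matrix (Fin (k + 1)) (Fin (k + 1)) ℝ | A.PosSemidef} := by
      simpa using Matrix.posSemidef_vecMulVec_self_star (v j)
    rw [h] at hv
    obtain ⟨X, ⟨h1, h2⟩, h3⟩ := hv
    exact ⟨X, h1, h2, h3⟩
  choose X hX hL hπ using hl
  obtain ⟨s, hs, hc⟩ := aux_comb X hX k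
  have hev : ∀ᶠ j in (Filter.hyperfilter ℕ : Filter ℕ), ∀ c,
      LinearMap.ker ((s.map X).sum c).mulVecLin ≤ LinearMap.ker (X j c).mulVecLin := by
    rw [Filter.eventually_all]
    intro c
    rcases hc c with h1 | h1
    · exact h1
    · have : LinearMap.ker ((s.map X).sum c).mulVecLin = ⊥ :=
        Submodule.finrank_eq_zero.1 (by omega)
      rw [this]
      exact Filter.Eventually.of_forall fun _ => bot_le
  have hns : ∀ᶠ j in (Filter.hyperfilter ℕ : Filter ℕ), j ∉ s := by
    have : {j | j ∈ s}.Finite := s.finite_toSet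
    exact this.compl_mem_hyperfilter
  obtain ⟨j, hj, hjs⟩ := (hev.and hns).exists
  obtain ⟨u, hu0, hu⟩ := aux_u k s hs j hjs
  have hA := aux_psd X hX s
  choose M hM0 hM using fun c => aux_dom (hA c) (hX j c) (hj c)
  have hAL : (s.map X).sum ∈ L := by
    apply list_sum_mem
    intro x hx
    obtain ⟨i, _, rfl⟩ := List.mem_map.1 hx
    exact hL i
  let Y := (∑ c, M c) • (s.map X).sum - X j
  have hYL : Y ∈ L := L.sub_mem (L.smul_mem _ hAL) (hL j)
  have hY : ∀ c, (Y c).PosSemidef := by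
    intro c
    have hMc : M c ≤ ∑ c, M c := Finset.single_le_sum (fun i _ => hM0 i) (Finset.mem_univ c)
    refine Matrix.PosSemidef.of_dotProduct_mulVec_nonneg ?_ fun x => ?_
    · refine Matrix.IsHermitian.sub ?_ (hX j c).1
      exact ((hA c).smul (Finset.sum_nonneg fun i _ => hM0 i)).1
    · have h1 := hM c x
      have h2 : 0 ≤ x ⬝ᵥ ((s.map X).sum c).mulVec x := by
        simpa using (hA c).dotProduct_mulVec_nonneg x
      have h3 := mul_le_mul_of_nonneg_right hMc h2
      simp only [Y, Pi.sub_apply, Pi.smul_apply, Matrix.sub_mulVec, Matrix.smul_mulVec,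
        dotProduct_sub, dotProduct_smul, star_trivial, smul_eq_mul]
      linarith
  have hπY : (π Y).PosSemidef := by
    have : π Y ∈ {A : Matrix (Fin (k + 1)) (Fin (k + 1)) ℝ | A.PosSemidef} := by
      rw [h]
      exact ⟨Y, ⟨hY, hYL⟩, rfl⟩
    exact this
  have hq : ∀ i, u ⬝ᵥ (π (X i)).mulVec u = (u ⬝ᵥ v i) ^ 2 := by
    intro i
    rw [hπ, Matrix.vecMulVec_mulVec]
    simp [dotProduct_comm (v i), sq]
  have hz : ∀ r : List ℕ, (∀ i ∈ r, u ⬝ᵥ v i = 0) → u ⬝ᵥ (π (r.map X).sum).mulVec u = 0 := by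
    intro r
    induction r with
    | nil => intro _; simp
    | cons i r ih =>
      intro hr
      have h1 := ih fun i hi => hr i (List.mem_cons_of_mem _ hi)
      rw [List.map_cons, List.sum_cons, map_add, Matrix.add_mulVec, dotProduct_add, h1, hq,
        hr i List.mem_cons_self]
      simp
  have h1 := hπY.dotProduct_mulVec_nonneg u
  simp only [Y, map_sub, map_smul, Matrix.sub_mulVec, Matrix.smul_mulVec, dotProduct_sub,
    dotProduct_smul, star_trivial, hq, hz s hu0] at h1
  have h2 : 0 < (u ⬝ᵥ v j) ^ 2 := by
    have : u ⬝ᵥ v j ≠ 0 := hu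
    positivity
  simp only [smul_zero, zero_sub] at h1
  linarith
end
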